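/- arXiv:0804.0901 — 8 statements merged into one kernel-verified Lean document; each statement's English description precedes it below -/
import Mathlib

section
/- For every positive integer m there exists a finite simple graph G = (V, E) with clique number ω(G) = m such that, for every partition of the vertex set V into two non-empty subsets V₁ and V₂, one has ω(G[V₁]) + ω(G[V₂]) > ω(G), where G[Vᵢ] denotes the subgraph of G induced on Vᵢ. -/
namespace SimpleGraph

/-- The vertex arrow relation `G → (a, b)`: whenever the vertices are split into `R` and its
complement, `R` contains an `a`-clique or the complement of `R` contains a `b`-clique. -/
def VertexArrow {V : Type*} (G : SimpleGraph V) (a b : ℕ) : Prop :=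
  ∀ R : Set V, (∃ s, G.IsNClique a s ∧ ↑s ⊆ R) ∨ ∃ s, G.IsNClique b s ∧ ↑s ⊆ Rᶜ

theorem IsNClique.map_embedding {V W : Type*} {G : SimpleGraph V} {G' : SimpleGraph W} {n : ℕ}
    {s : Finset V} (hs : G.IsNClique n s) (e : G ↪g G') :
    G'.IsNClique n (s.map e.toEmbedding) :=
  hs.map.mono ((map_le_iff_le_comap _ _ _).2 fun _ _ h ↦ e.map_adj_iff.2 h)

theorem CliqueFree.not_subset_range {V W : Type*} {G : SimpleGraph V} {G' : SimpleGraph W} {n : ℕ}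
    {t : Finset W} (hG : G.CliqueFree n) (ht : G'.IsNClique n t) (e : G ↪g G') :
    ¬ (t : Set W) ⊆ Set.range e := by
  intro h
  obtain ⟨s, rfl⟩ : ∃ s : Finset V, s.map e.toEmbedding = t := by
    classical
    rw [← Set.image_univ, Finset.subset_set_image_iff] at h
    obtain ⟨s, -, hs⟩ := h
    exact ⟨s, (Finset.map_eq_image _ _).trans hs⟩
  refine hG s ⟨fun x hx y hy hxy ↦ e.map_adj_iff.1 ?_, by simpa using ht.card_eq⟩
  exact ht.isClique (by simpa using hx) (by simpa using hy) (e.injective.ne hxy)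

section Amalgam

variable {V W : Type*} (H : SimpleGraph V) (K : SimpleGraph W) (a b : ℕ)

/-- The vertices of the Folkman amalgam: pairs of an `a`-clique `i` of `H` and a `b`-clique `j` of
`K`, copies of `H` indexed by the maps from `a`-cliques to `b`-cliques, and copies of `K` indexed
by the `a`-cliques. -/
abbrev FolkmanVertex : Type _ :=
  ({s // H.IsNClique a s} × {s // K.IsNClique b s}) ⊕
    ((({s // H.IsNClique a s} → {s // K.IsNClique b s}) × V) ⊕ ({s // H.IsNClique a s} × W))

/-- The edges between the pairs and the copies of `H` and `K`, and inside these copies. The pair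
`(i, j)` is joined to the clique `i` in the copies of `H` with index `f` such that `f i = j`, and to
the clique `j` in the copy of `K` with index `i`. -/
def folkmanAdj : FolkmanVertex H K a b → FolkmanVertex H K a b → Prop
  | .inl _, .inl _ => False
  | .inl p, .inr (.inl q) => q.1 p.1 = p.2 ∧ q.2 ∈ p.1.1
  | .inl p, .inr (.inr q) => q.1 = p.1 ∧ q.2 ∈ p.2.1
  | .inr (.inl q), .inl p => q.1 p.1 = p.2 ∧ q.2 ∈ p.1.1
  | .inr (.inr q), .inl p => q.1 = p.1 ∧ q.2 ∈ p.2.1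
  | .inr (.inl q), .inr (.inl q') => q.1 = q'.1 ∧ H.Adj q.2 q'.2
  | .inr (.inr q), .inr (.inr q') => q.1 = q'.1 ∧ K.Adj q.2 q'.2
  | .inr (.inl _), .inr (.inr _) => False
  | .inr (.inr _), .inr (.inl _) => False

/-- The Folkman amalgam of `H` and `K`. -/
def folkmanAmalgam : SimpleGraph (FolkmanVertex H K a b) where
  Adj := folkmanAdj H K a b
  symm := ⟨by
    rintro (p | p | p) (q | q | q) h <;> simp only [folkmanAdj] at h ⊢
    all_goals first | exact h | exact ⟨h.1.symm, h.2.symm⟩⟩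
  loopless := ⟨by rintro (p | p | p) h <;> simp [folkmanAdj] at h⟩

variable {H K a b}

/-- The copy of `H` with index `f` in the Folkman amalgam. -/
def folkmanCopyLeft (f : {s // H.IsNClique a s} → {s // K.IsNClique b s}) :
    H ↪g folkmanAmalgam H K a b where
  toFun v := .inr (.inl (f, v))
  inj' _ _ := by simp
  map_rel_iff' := and_iff_right rfl

/-- The copy of `K` with index `i` in the Folkman amalgam. -/
def folkmanCopyRight (i : {s // H.IsNClique a s}) : K ↪g folkmanAmalgam H K a b where
  toFun v := .inr (.inr (i, v))
  inj' _ _ := by simp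
  map_rel_iff' := and_iff_right rfl

theorem folkmanAmalgam_cliqueFree {n : ℕ} (hH : H.CliqueFree (n + 1)) (hK : K.CliqueFree (n + 1))
    (ha : a < n) (hb : b < n) : (folkmanAmalgam H K a b).CliqueFree (n + 1) := by
  classical
  intro s hs
  have hadj : ∀ x ∈ s, ∀ y ∈ s, x ≠ y → folkmanAdj H K a b x y := fun x hx y hy h ↦
    hs.isClique hx hy h
  have hcard := hs.card_eq
  by_cases hp : ∃ p, Sum.inl p ∈ s
  · obtain ⟨p, hp⟩ := hp
    have hcard' : (s.erase (.inl p)).card = n := by rw [Finset.card_erase_of_mem hp]; omega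
    obtain ⟨x, hx⟩ : (s.erase (.inl p)).Nonempty := by rw [← Finset.card_pos]; omega
    have hmem := fun y hy ↦ hadj (.inl p) hp y (Finset.mem_of_mem_erase hy)
      (Finset.ne_of_mem_erase hy).symm
    have hxs := Finset.mem_of_mem_erase hx
    rcases x with q | q | q
    · exact (hmem _ hx).elim
    · have hsub : s.erase (.inl p) ⊆ p.1.1.image fun v ↦ .inr (.inl (q.1, v)) := by
        rintro (y | ⟨f, v⟩ | y) hy
        · exact (hmem _ hy).elim
        · have h := (hmem _ hy).2
          rcases eq_or_ne (Sum.inr (Sum.inl q)) (Sum.inr (Sum.inl (f, v))) with e | e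
          · simp only [Sum.inr.injEq, Sum.inl.injEq] at e
            subst e
            exact Finset.mem_image_of_mem _ h
          · obtain rfl : q.1 = f := (hadj _ hxs _ (Finset.mem_of_mem_erase hy) e).1
            exact Finset.mem_image_of_mem _ h
        · exact (hadj _ hxs _ (Finset.mem_of_mem_erase hy) (by simp)).elim
      have := (Finset.card_le_card hsub).trans Finset.card_image_le
      rw [p.1.2.card_eq] at this
      omega
    · have hsub : s.erase (.inl p) ⊆ p.2.1.image fun v ↦ .inr (.inr (p.1, v)) := by
        rintro (y | y | ⟨f, v⟩) hy
        · exact (hmem _ hy).elim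
        · exact (hadj _ hxs _ (Finset.mem_of_mem_erase hy) (by simp)).elim
        · obtain ⟨rfl, h⟩ := hmem _ hy
          exact Finset.mem_image_of_mem _ h
      have := (Finset.card_le_card hsub).trans Finset.card_image_le
      rw [p.2.2.card_eq] at this
      omega
  · push Not at hp
    obtain ⟨x, hx⟩ : s.Nonempty := by rw [← Finset.card_pos]; omega
    rcases x with q | q | q
    · exact hp _ hx
    · refine hH.not_subset_range hs (folkmanCopyLeft q.1) ?_
      rintro (y | ⟨f, v⟩ | y) hy
      · exact (hp _ hy).elim
      · rcases eq_or_ne (Sum.inr (Sum.inl q)) (Sum.inr (Sum.inl (f, v))) with e | e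
        · exact ⟨q.2, e⟩
        · obtain rfl : q.1 = f := (hadj _ hx _ hy e).1
          exact ⟨v, rfl⟩
      · exact (hadj _ hx _ hy (by simp)).elim
    · refine hK.not_subset_range hs (folkmanCopyRight q.1) ?_
      rintro (y | y | ⟨i, v⟩) hy
      · exact (hp _ hy).elim
      · exact (hadj _ hx _ hy (by simp)).elim
      · rcases eq_or_ne (Sum.inr (Sum.inr q)) (Sum.inr (Sum.inr (i, v))) with e | e
        · exact ⟨q.2, e⟩
        · obtain rfl : q.1 = i := (hadj _ hx _ hy e).1
          exact ⟨v, rfl⟩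

theorem VertexArrow.folkmanAmalgam (hH : H.VertexArrow a (b + 1)) (hK : K.VertexArrow (a + 1) b) :
    (folkmanAmalgam H K a b).VertexArrow (a + 1) (b + 1) := by
  classical
  intro R
  by_cases h : ∀ i, ∃ j, Sum.inl (i, j) ∈ R
  · choose f hf using h
    rcases hH {v | .inr (.inl (f, v)) ∈ R} with ⟨s, hs, hsR⟩ | ⟨s, hs, hsR⟩
    · refine .inl ⟨_, (hs.map_embedding (folkmanCopyLeft f)).insert
        (a := .inl (⟨s, hs⟩, f ⟨s, hs⟩)) ?_, ?_⟩
      · simp only [Finset.mem_map]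
        rintro _ ⟨v, hv, rfl⟩
        exact ⟨rfl, hv⟩
      · simp only [Finset.coe_insert, Finset.coe_map, Set.insert_subset_iff, Set.image_subset_iff]
        exact ⟨hf _, hsR⟩
    · refine .inr ⟨_, hs.map_embedding (folkmanCopyLeft f), ?_⟩
      simp only [Finset.coe_map, Set.image_subset_iff]
      exact hsR
  · push Not at h
    obtain ⟨i, hi⟩ := h
    rcases hK {v | .inr (.inr (i, v)) ∈ R} with ⟨s, hs, hsR⟩ | ⟨s, hs, hsR⟩
    · refine .inl ⟨_, hs.map_embedding (folkmanCopyRight i), ?_⟩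
      simp only [Finset.coe_map, Set.image_subset_iff]
      exact hsR
    · refine .inr ⟨_, (hs.map_embedding (folkmanCopyRight i)).insert
        (a := .inl (i, ⟨s, hs⟩)) ?_, ?_⟩
      · simp only [Finset.mem_map]
        rintro _ ⟨v, hv, rfl⟩
        exact ⟨rfl, hv⟩
      · simp only [Finset.coe_insert, Finset.coe_map, Set.insert_subset_iff, Set.image_subset_iff]
        exact ⟨hi _, hsR⟩

end Amalgam

/-- Folkman's theorem on vertex colourings with two colours. -/
theorem exists_cliqueFree_vertexArrow (n : ℕ) : ∀ a b : ℕ, a ≤ n → b ≤ n →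
    ∃ (V : Type) (_ : Finite V) (G : SimpleGraph V), G.CliqueFree (n + 1) ∧ G.VertexArrow a b
  | 0, _, _, _ => ⟨Empty, inferInstance, ⊥, cliqueFree_of_card_lt (by simp),
      fun _ ↦ .inl ⟨∅, by simp [isNClique_iff], by simp⟩⟩
  | _ + 1, 0, _, _ => ⟨Empty, inferInstance, ⊥, cliqueFree_of_card_lt (by simp),
      fun _ ↦ .inr ⟨∅, by simp [isNClique_iff], by simp⟩⟩
  | a + 1, b + 1, ha, hb => by
    obtain ⟨V, _, H, hH, hHab⟩ := exists_cliqueFree_vertexArrow n a (b + 1) (by omega) hb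
    obtain ⟨W, _, K, hK, hKab⟩ := exists_cliqueFree_vertexArrow n (a + 1) b ha (by omega)
    exact ⟨FolkmanVertex H K a b, inferInstance, folkmanAmalgam H K a b,
      folkmanAmalgam_cliqueFree hH hK ha hb, hHab.folkmanAmalgam hKab⟩

theorem IsNClique.le_cliqueNum_induce {V : Type*} [Finite V] {G : SimpleGraph V} {n : ℕ}
    {s : Finset V} (hs : G.IsNClique n s) {A : Set V} (hA : ↑s ⊆ A) :
    n ≤ (G.induce A).cliqueNum := by
  classical
  have h : (G.induce A).IsNClique n (s.subtype (· ∈ A)) := by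
    refine ⟨fun x hx y hy hxy ↦ hs.isClique (by simpa using hx) (by simpa using hy)
      (Subtype.coe_injective.ne hxy), ?_⟩
    rw [Finset.card_subtype, Finset.filter_true_of_mem fun x hx ↦ hA hx, hs.card_eq]
  exact h.card_eq ▸ h.isClique.card_le_cliqueNum

theorem one_le_cliqueNum_induce {V : Type*} [Finite V] (G : SimpleGraph V) {A : Set V}
    (hA : A.Nonempty) : 1 ≤ (G.induce A).cliqueNum := by
  obtain ⟨x, hx⟩ := hA
  exact IsNClique.le_cliqueNum_induce (s := {x}) (by simp [isNClique_iff]) (by simpa using hx)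

end SimpleGraph

/-- For every positive integer `m` there exists a finite simple graph `G`
with clique number `m` such that for every partition of the vertex set into two
non-empty parts `V₁, V₂`, one has `ω(G[V₁]) + ω(G[V₂]) > ω(G)`. -/
theorem stmt0 (m : ℕ) (hm : 0 < m) :
    ∃ (V : Type) (_ : Fintype V) (G : SimpleGraph V),
      G.cliqueNum = m ∧
      ∀ V₁ V₂ : Set V, V₁.Nonempty → V₂.Nonempty → Disjoint V₁ V₂ → V₁ ∪ V₂ = Set.univ →
        (G.induce V₁).cliqueNum + (G.induce V₂).cliqueNum > G.cliqueNum := by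
  obtain ⟨V, _, G, hfree, harrow⟩ := SimpleGraph.exists_cliqueFree_vertexArrow m m m le_rfl le_rfl
  have hnum : G.cliqueNum = m := by
    apply le_antisymm
    · obtain ⟨s, hs⟩ := G.exists_isNClique_cliqueNum
      by_contra! h
      exact hfree.mono h s hs
    · rcases harrow Set.univ with ⟨s, hs, -⟩ | ⟨s, hs, -⟩ <;>
        exact hs.card_eq ▸ hs.isClique.card_le_cliqueNum
  refine ⟨V, Fintype.ofFinite V, G, hnum, fun V₁ V₂ h₁ h₂ hd hu ↦ ?_⟩
  have hc : V₁ᶜ = V₂ := (IsCompl.of_eq hd.eq_bot hu).compl_eq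
  have h₁ := G.one_le_cliqueNum_induce h₁
  have h₂ := G.one_le_cliqueNum_induce h₂
  rw [hnum]
  rcases harrow V₁ with ⟨s, hs, hsub⟩ | ⟨s, hs, hsub⟩
  · have := hs.le_cliqueNum_induce hsub
    omega
  · have := hs.le_cliqueNum_induce (hc ▸ hsub)
    omega
end

section
/- For every positive integer m and every integer k ≥ 2 there exists a finite simple graph G = (V, E) with clique number ω(G) = m such that, for every partition of the vertex set V into k subsets V₁, V₂, …, V_k (equivalently, for every coloring c : V → {1, …, k}), there exists some index i with ω(G[Vᵢ]) = ω(G) = m, where G[Vᵢ] denotes the subgraph of G induced on Vᵢ. -/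
open Function

lemma exists_monochromatic_embedding (F : Type) [Fintype F] (k : ℕ)
    (c : Fin (k * Fintype.card F + 1) → Fin k) :
    ∃ (i : Fin k) (e : F ↪ Fin (k * Fintype.card F + 1)), ∀ x, c (e x) = i := by
  classical
  obtain ⟨i, hi⟩ := Fintype.exists_lt_card_fiber_of_mul_lt_card c
    (n := Fintype.card F) (by simp)
  have hle : Fintype.card F ≤ Fintype.card {x // c x = i} := by
    rw [Fintype.card_subtype]
    exact hi.le
  obtain ⟨e⟩ := Embedding.nonempty_of_card_le hle
  exact ⟨i, e.trans (Embedding.subtype _), fun x ↦ (e x).2⟩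

namespace SimpleGraph

lemma cliqueNum_eq_of_pairwise_adj {V : Type} [Finite V] (G : SimpleGraph V) {m : ℕ}
    (f : Fin m → V) (hf : Pairwise fun a b ↦ G.Adj (f a) (f b))
    (hfree : ¬ ∃ g : Fin (m + 1) → V, Pairwise fun a b ↦ G.Adj (g a) (g b)) :
    G.cliqueNum = m := by
  have : Fintype V := Fintype.ofFinite V
  refine le_antisymm ?_ ?_
  · obtain ⟨s, hs⟩ := G.exists_isNClique_cliqueNum
    by_contra! hlt
    have hle : Fintype.card (Fin (m + 1)) ≤ Fintype.card s := by
      simpa [hs.card_eq] using hlt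
    obtain ⟨e⟩ := Embedding.nonempty_of_card_le hle
    refine hfree ⟨fun a ↦ e a, fun a b hab ↦ hs.isClique (e a).2 (e b).2 fun h ↦ hab ?_⟩
    exact e.injective (Subtype.ext h)
  · have hinj : Injective f := fun a b hab ↦ by
      by_contra h
      exact (hf h).ne hab
    have hclique : G.IsClique (Finset.univ.map ⟨f, hinj⟩ : Finset V) := by
      intro x hx y hy hxy
      simp only [Finset.coe_map, Embedding.coeFn_mk, Finset.coe_univ, Set.image_univ,
        Set.mem_range] at hx hy
      obtain ⟨a, rfl⟩ := hx
      obtain ⟨b, rfl⟩ := hy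
      exact hf fun h ↦ hxy (congrArg f h)
    simpa using hclique.card_le_cliqueNum

/-- Copies of `G`, one for each embedding of the part `p ⁻¹' {i}` into `X`, glued along `X`
and otherwise disjoint. -/
def amalgam {V P X : Type} (G : SimpleGraph V) (p : V → P) (i : P) :
    SimpleGraph (X ⊕ ({v // p v = i} ↪ X) × {v // p v ≠ i}) where
  Adj
    | .inl _, .inl _ => False
    | .inl x, .inr (e, r) => ∃ v, e v = x ∧ G.Adj v r
    | .inr (e, r), .inl x => ∃ v, e v = x ∧ G.Adj v r
    | .inr (e, r), .inr (e', r') => e = e' ∧ G.Adj r r'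
  symm := ⟨by
    rintro (x | ⟨e, r⟩) (y | ⟨e', r'⟩) h
    · exact h
    · exact h
    · exact h
    · exact ⟨h.1.symm, h.2.symm⟩⟩
  loopless := ⟨by
    rintro (x | ⟨e, r⟩) h
    · exact h
    · exact h.2.ne rfl⟩

open Classical in
/-- The inclusion of the copy of `G` indexed by `e` into the amalgam. -/
noncomputable def toAmalgam {V P X : Type} (p : V → P) (i : P) (e : {v // p v = i} ↪ X) (v : V) :
    X ⊕ ({v // p v = i} ↪ X) × {v // p v ≠ i} :=
  if h : p v = i then .inl (e ⟨v, h⟩) else .inr (e, ⟨v, h⟩)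

lemma amalgam_adj_toAmalgam {V P X : Type} {G : SimpleGraph V} {p : V → P}
    (hp : ∀ u v, G.Adj u v → p u ≠ p v) (i : P) (e : {v // p v = i} ↪ X) (u v : V) :
    (G.amalgam p i).Adj (toAmalgam p i e u) (toAmalgam p i e v) ↔ G.Adj u v := by
  by_cases hu : p u = i <;> by_cases hv : p v = i <;> simp only [toAmalgam, hu, hv, dif_pos,
    dif_neg, not_false_eq_true, amalgam]
  · exact ⟨False.elim, fun h ↦ hp u v h (hu.trans hv.symm)⟩
  · constructor
    · rintro ⟨w, hw, h⟩
      rwa [e.injective hw] at h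
    · exact fun h ↦ ⟨_, rfl, h⟩
  · constructor
    · rintro ⟨w, hw, h⟩
      rw [e.injective hw] at h
      exact h.symm
    · exact fun h ↦ ⟨_, rfl, h.symm⟩
  · simp

lemma exists_eq_toAmalgam {V P X : Type} {G : SimpleGraph V} {p : V → P} {i : P}
    {e : {v // p v = i} ↪ X} {r : {v // p v ≠ i}}
    {y : X ⊕ ({v // p v = i} ↪ X) × {v // p v ≠ i}}
    (h : y = .inr (e, r) ∨ (G.amalgam p i).Adj (.inr (e, r)) y) :
    ∃ v, toAmalgam p i e v = y := by
  have key (r : {v // p v ≠ i}) : toAmalgam p i e r = .inr (e, r) := by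
    simp [toAmalgam, r.2]
  rcases h with rfl | h
  · exact ⟨r, key r⟩
  · rcases y with x | ⟨e', r'⟩
    · obtain ⟨v, rfl, -⟩ := h
      exact ⟨v, by simp [toAmalgam, v.2]⟩
    · obtain ⟨rfl, -⟩ := h
      exact ⟨r', key r'⟩

/-- Partite vertex-Folkman graphs for colorings prescribed by `d` on all parts outside `S`. -/
lemma exists_partite_folkman {m : ℕ} (hm : 0 < m) (k : ℕ)
    (S : Finset (Fin (k * m + 1))) :
    ∃ (V : Type) (_ : Finite V) (G : SimpleGraph V) (p : V → Fin (k * m + 1)),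
      (∀ u v, G.Adj u v → p u ≠ p v) ∧
      (¬ ∃ g : Fin (m + 1) → V, Pairwise fun a b ↦ G.Adj (g a) (g b)) ∧
      ∀ (c : V → Fin k) (d : Fin (k * m + 1) → Fin k), (∀ v, p v ∉ S → c v = d (p v)) →
        ∃ (i : Fin k) (f : Fin m → V),
          (Pairwise fun a b ↦ G.Adj (f a) (f b)) ∧ ∀ a, c (f a) = i := by
  classical
  induction S using Finset.induction_on with
  | empty =>
    let G : SimpleGraph ((Fin m ↪ Fin (k * m + 1)) × Fin m) :=
      { Adj := fun x y ↦ x.1 = y.1 ∧ x.2 ≠ y.2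
        symm := ⟨fun _ _ h ↦ ⟨h.1.symm, h.2.symm⟩⟩
        loopless := ⟨fun _ h ↦ h.2 rfl⟩ }
    refine ⟨_, inferInstance, G, fun x ↦ x.1 x.2, ?_, ?_, ?_⟩
    · rintro ⟨e, a⟩ ⟨e', b⟩ ⟨h, hab⟩
      obtain rfl : e = e' := h
      exact fun h ↦ hab (e.injective h)
    · rintro ⟨g, hg⟩
      obtain ⟨a, b, hab, h⟩ :=
        Fintype.exists_ne_map_eq_of_card_lt (fun a ↦ (g a).2) (by simp)
      exact (hg hab).2 h
    · intro c d hcd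
      obtain ⟨i, e, he⟩ : ∃ (i : Fin k) (e : Fin m ↪ Fin (k * m + 1)), ∀ x, d (e x) = i := by
        have h := exists_monochromatic_embedding (Fin m) k
        rw [Fintype.card_fin] at h
        exact h d
      exact ⟨i, fun a ↦ (e, a), fun a b hab ↦ ⟨rfl, hab⟩,
        fun a ↦ (hcd _ (Finset.notMem_empty _)).trans (he a)⟩
  | insert i S _ ih =>
    obtain ⟨V, _, G, p, hp, hfree, hmono⟩ := ih
    have : Fintype V := Fintype.ofFinite V
    let X := Fin (k * Fintype.card {v // p v = i} + 1)
    refine ⟨X ⊕ ({v // p v = i} ↪ X) × {v // p v ≠ i}, inferInstance, G.amalgam p i,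
      Sum.elim (fun _ ↦ i) (fun y ↦ p y.2), ?_, ?_, ?_⟩
    · rintro (x | ⟨e, r⟩) (y | ⟨e', r'⟩) h
      · exact h.elim
      · exact r'.2.symm
      · exact r.2
      · exact hp _ _ h.2
    · rintro ⟨g, hg⟩
      by_cases hr : ∃ a y, g a = .inr y
      · obtain ⟨a, ⟨e, r⟩, ha⟩ := hr
        have hex (b) : ∃ v, toAmalgam p i e v = g b := by
          refine exists_eq_toAmalgam (G := G) (r := r) ?_
          rw [← ha]
          rcases eq_or_ne a b with rfl | hab
          · exact .inl rfl
          · exact .inr (hg hab)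
        choose q hq using hex
        refine hfree ⟨q, fun a b hab ↦ ?_⟩
        refine (amalgam_adj_toAmalgam hp i e _ _).1 ?_
        rw [hq, hq]
        exact hg hab
      · push Not at hr
        have hne : (0 : Fin (m + 1)) ≠ Fin.last m := by
          simpa [Fin.ext_iff] using hm.ne
        have h : (G.amalgam p i).Adj (g 0) (g (Fin.last m)) := hg hne
        rcases h0 : g 0 with x | y
        · rcases h1 : g (Fin.last m) with x' | y'
          · rw [h0, h1] at h
            exact h
          · exact hr _ _ h1
        · exact hr _ _ h0
    · intro c d hcd
      obtain ⟨j, e, he⟩ := exists_monochromatic_embedding {v // p v = i} k (fun x ↦ c (.inl x))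
      obtain ⟨l, f, hf, hl⟩ := hmono (fun v ↦ c (toAmalgam p i e v)) (update d i j) (by
        intro v hv
        by_cases h : p v = i
        · simp [toAmalgam, h, he]
        · simp only [toAmalgam, h, dif_neg, not_false_eq_true, update_of_ne, ne_eq]
          exact hcd _ (by simp [h, hv]))
      exact ⟨l, fun a ↦ toAmalgam p i e (f a),
        fun a b hab ↦ (amalgam_adj_toAmalgam hp i e _ _).2 (hf hab), hl⟩

end SimpleGraph


/-- For every positive integer `m` and every `k ≥ 2` there exists a finite
simple graph `G` with clique number `m` such that for every partition of the vertices
into `k` parts (equivalently, every coloring `c : V → Fin k`) some part induces a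
subgraph of full clique number `m`. -/
theorem stmt1 (m k : ℕ) (hm : 0 < m) (hk : 2 ≤ k) :
    ∃ (V : Type) (_ : Fintype V) (G : SimpleGraph V),
      G.cliqueNum = m ∧
      ∀ c : V → Fin k, ∃ i : Fin k,
        (G.induce (c ⁻¹' {i})).cliqueNum = G.cliqueNum ∧
        (G.induce (c ⁻¹' {i})).cliqueNum = m := by
  obtain ⟨V, _, G, p, -, hfree, hmono⟩ :=
    SimpleGraph.exists_partite_folkman hm k Finset.univ
  have hmono' (c : V → Fin k) := hmono c (fun _ ↦ ⟨0, by omega⟩) (by simp)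
  have hG : G.cliqueNum = m := by
    obtain ⟨-, f, hf, -⟩ := hmono' fun _ ↦ ⟨0, by omega⟩
    exact G.cliqueNum_eq_of_pairwise_adj f hf hfree
  refine ⟨V, Fintype.ofFinite V, G, hG, fun c ↦ ?_⟩
  obtain ⟨i, f, hf, hi⟩ := hmono' c
  have hi' : (G.induce (c ⁻¹' {i})).cliqueNum = m :=
    SimpleGraph.cliqueNum_eq_of_pairwise_adj _ (fun a ↦ ⟨f a, hi a⟩) (fun a b hab ↦ hf hab)
      fun ⟨g, hg⟩ ↦ hfree ⟨fun a ↦ g a, fun a b hab ↦ hg hab⟩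
  exact ⟨i, hi'.trans hG.symm, hi'⟩
end

section
/- For every positive integer k there exists a finite simple graph that contains no triangle (no complete subgraph on 3 vertices) and whose chromatic number equals k. -/
namespace SimpleGraph

/-- Adjacency in the Mycielskian of `G`: `some (inl v)` are the original vertices,
`some (inr v)` their shadows, and `none` is the apex. -/
def MycielskianAdj {V : Type*} (G : SimpleGraph V) : Option (V ⊕ V) → Option (V ⊕ V) → Prop
  | some (.inl v), some (.inl w) => G.Adj v w
  | some (.inl v), some (.inr w) => G.Adj v w
  | some (.inr v), some (.inl w) => G.Adj v w
  | some (.inr _), none => True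
  | none, some (.inr _) => True
  | _, _ => False

/-- The Mycielskian of a graph. -/
def mycielskian {V : Type*} (G : SimpleGraph V) : SimpleGraph (Option (V ⊕ V)) where
  Adj := G.MycielskianAdj
  symm := ⟨by
    rintro (_ | v | v) (_ | w | w) h <;> simp_all [MycielskianAdj, G.adj_comm]⟩
  loopless := ⟨by
    rintro (_ | v | v) h <;> simp_all [MycielskianAdj]⟩

variable {V : Type*} {G : SimpleGraph V}

theorem cliqueFree_three_iff_not_adj :
    G.CliqueFree 3 ↔ ∀ a b c, G.Adj a b → G.Adj a c → ¬ G.Adj b c := by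
  classical
  constructor
  · intro h a b c hab hac hbc
    exact h {a, b, c} (is3Clique_triple_iff.2 ⟨hab, hac, hbc⟩)
  · intro h s hs
    obtain ⟨a, b, c, hab, hac, hbc, -⟩ := is3Clique_iff.1 hs
    exact h a b c hab hac hbc

theorem CliqueFree.mycielskian (h : G.CliqueFree 3) : G.mycielskian.CliqueFree 3 := by
  rw [cliqueFree_three_iff_not_adj] at h ⊢
  rintro (_ | a | a) (_ | b | b) (_ | c | c) <;>
    simp only [SimpleGraph.mycielskian, MycielskianAdj] <;> tauto

theorem Colorable.mycielskian {n : ℕ} (h : G.Colorable n) : G.mycielskian.Colorable (n + 1) := by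
  obtain ⟨C⟩ := h
  let D : G.mycielskian.Coloring (Option (Fin n)) :=
    Coloring.mk (Option.map (Sum.elim C C)) (by
      rintro (_ | v | v) (_ | w | w) h <;>
        simp_all [SimpleGraph.mycielskian, MycielskianAdj, C.valid])
  simpa using D.colorable

theorem Colorable.of_mycielskian {n : ℕ} (h : G.mycielskian.Colorable (n + 1)) :
    G.Colorable n := by
  obtain ⟨C⟩ := h
  have shadow_ne (v : V) : C (some (.inr v)) ≠ C none :=
    C.valid (by simp [SimpleGraph.mycielskian, MycielskianAdj])
  let D : G.Coloring {x // x ≠ C none} :=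
    Coloring.mk
      (fun v => if hv : C (some (.inl v)) = C none then ⟨C (some (.inr v)), shadow_ne v⟩
        else ⟨C (some (.inl v)), hv⟩) (by
      intro v w hvw
      have h₁ : C (some (.inl v)) ≠ C (some (.inl w)) := C.valid (show G.Adj v w from hvw)
      have h₂ : C (some (.inl v)) ≠ C (some (.inr w)) := C.valid (show G.Adj v w from hvw)
      have h₃ : C (some (.inr v)) ≠ C (some (.inl w)) := C.valid (show G.Adj v w from hvw)
      split_ifs <;> simp_all)
  simpa using D.colorable

theorem chromaticNumber_mycielskian {n : ℕ} (h : G.chromaticNumber = (n + 1 : ℕ)) :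
    G.mycielskian.chromaticNumber = (n + 1 + 1 : ℕ) := by
  have h' := chromaticNumber_eq_iff_colorable_not_colorable.1 h
  exact chromaticNumber_eq_iff_colorable_not_colorable.2
    ⟨h'.1.mycielskian, fun hc => h'.2 hc.of_mycielskian⟩

end SimpleGraph

/-- For every positive integer `k` there exists a finite triangle-free
simple graph whose chromatic number equals `k`. -/
theorem stmt3 (k : ℕ) (hk : 0 < k) :
    ∃ (V : Type) (_ : Fintype V) (G : SimpleGraph V),
      G.CliqueFree 3 ∧ G.chromaticNumber = k := by
  induction k, hk using Nat.le_induction with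
  | base =>
    exact ⟨Unit, inferInstance, ⊥, SimpleGraph.cliqueFree_bot (by norm_num),
      by simpa using SimpleGraph.chromaticNumber_bot⟩
  | succ k hk ih =>
    obtain ⟨V, _, G, hG, hχ⟩ := ih
    obtain ⟨n, rfl⟩ := Nat.exists_eq_add_of_le' hk
    exact ⟨Option (V ⊕ V), inferInstance, G.mycielskian, hG.mycielskian,
      SimpleGraph.chromaticNumber_mycielskian hχ⟩
end

section
/- For every finite simple graph G = (V, E) with vertex set V = {v₁, …, v_s} there exists a finite system of residue classes 𝒜 = {a_t(n_t)}_{t=1}^{s} (with each n_t a positive integer and a_t an integer) such that G is an intersection graph of 𝒜, i.e., for all 1 ≤ i < j ≤ s, the intersection a_i(n_i) ∩ a_j(n_j) is non-empty if and only if v_i v_j is an edge of G. -/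
theorem exists_injective_prime_gt (α : Type*) [Finite α] (s : ℕ) :
    ∃ p : α → ℕ, Function.Injective p ∧ ∀ e, (p e).Prime ∧ s < p e := by
  obtain ⟨m, ⟨f⟩⟩ := Finite.exists_equiv_fin α
  refine ⟨fun e => Nat.nth Nat.Prime (s + f e), fun e e' h => ?_, fun e =>
    ⟨Nat.prime_nth_prime _, ?_⟩⟩
  · have h' := Nat.nth_injective Nat.infinite_setOfPred_prime h
    exact f.injective (Fin.ext (by omega))
  · have := Nat.add_two_le_nth_prime (s + f e)
    dsimp only
    omega

/-- For every finite simple graph `G` on vertices `v₁, …, v_s`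
(indexed by `Fin s`) there is a system of residue classes `a_t (n_t)`, `t = 1, …, s`,
of which `G` is an intersection graph: for `i < j`, the classes `a_i (n_i)` and
`a_j (n_j)` intersect iff `v_i v_j` is an edge of `G`. -/
theorem stmt6 (s : ℕ) (G : SimpleGraph (Fin s)) :
    ∃ (a : Fin s → ℤ) (n : Fin s → ℕ),
      (∀ t, 0 < n t) ∧
      ∀ i j : Fin s, i < j →
        ((∃ x : ℤ, x ≡ a i [ZMOD (n i : ℤ)] ∧ x ≡ a j [ZMOD (n j : ℤ)]) ↔ G.Adj i j) := by
  classical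
  obtain ⟨p, hp, hps⟩ := exists_injective_prime_gt (Sym2 (Fin s)) s
  let S : Fin s → Finset (Fin s) := fun t => {k | k ≠ t ∧ ¬ G.Adj t k}
  let n : Fin s → ℕ := fun t => ∏ k ∈ S t, p s(t, k)
  refine ⟨fun t => ((t : ℕ) : ℤ), n, fun t => Finset.prod_pos fun k _ => (hps _).1.pos,
    fun i j hij => ⟨?_, fun hadj => ?_⟩⟩
  · rintro ⟨x, hxi, hxj⟩
    by_contra hadj
    have hi : p s(i, j) ∣ n i :=
      Finset.dvd_prod_of_mem (fun k => p s(i, k)) (by simp [S, hadj, hij.ne'])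
    have hj : p s(i, j) ∣ n j := by
      rw [Sym2.eq_swap]
      exact Finset.dvd_prod_of_mem (fun k => p s(j, k)) (by simp [S, G.adj_comm j i, hadj, hij.ne])
    have hmod := (hxi.of_dvd (Int.natCast_dvd_natCast.2 hi)).symm.trans
      (hxj.of_dvd (Int.natCast_dvd_natCast.2 hj))
    have heq := (Int.natCast_modEq_iff.1 hmod).eq_of_lt_of_lt
      (i.isLt.trans (hps _).2) (j.isLt.trans (hps _).2)
    exact hij.ne (Fin.ext heq)
  · have hco : (n i).Coprime (n j) := by
      refine Nat.Coprime.prod_left fun k hk => Nat.Coprime.prod_right fun l _ => ?_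
      refine (Nat.coprime_primes (hps _).1 (hps _).1).2 fun h => ?_
      rcases Sym2.eq_iff.1 (hp h) with ⟨h, -⟩ | ⟨-, rfl⟩
      · exact hij.ne h
      · exact (Finset.mem_filter.1 hk).2.2 hadj
    obtain ⟨x, hxi, hxj⟩ := Nat.chineseRemainder hco i j
    exact ⟨x, Int.natCast_modEq_iff.2 hxi, Int.natCast_modEq_iff.2 hxj⟩
end

section
/- Let 𝒜 = {a_t(n_t)}_{t=1}^{s} be a finite system of residue classes and let G = (V, E) with V = {v₁, …, v_s} be an intersection graph of 𝒜. Then the clique number of G equals the maximum of the covering function of 𝒜: ω(G) = max{w_𝒜(x) : x ∈ ℤ}, where w_𝒜(x) = |{1 ≤ t ≤ s : x ∈ a_t(n_t)}|. -/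
/-- The covering function of the subsystem `{a_t (n_t) : t ∈ I}` of a system of
residue classes: `coverFun a n I x` is the number of `t ∈ I` with `x ∈ a_t (n_t)`. -/
noncomputable def coverFun {s : ℕ} (a : Fin s → ℤ) (n : Fin s → ℕ)
    (I : Finset (Fin s)) (x : ℤ) : ℕ :=
  (I.filter fun t => x ≡ a t [ZMOD (n t : ℤ)]).card

theorem Nat.gcd_lcm_dvd_lcm_gcd {a b c : ℕ} (ha : a ≠ 0) (hb : b ≠ 0) (hc : c ≠ 0) :
    Nat.gcd (Nat.lcm a b) c ∣ Nat.lcm (Nat.gcd a c) (Nat.gcd b c) := by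
  have hac : Nat.gcd a c ≠ 0 := Nat.gcd_ne_zero_left ha
  have hbc : Nat.gcd b c ≠ 0 := Nat.gcd_ne_zero_left hb
  have hab : Nat.lcm a b ≠ 0 := Nat.lcm_ne_zero ha hb
  rw [← Nat.factorization_le_iff_dvd (Nat.gcd_ne_zero_left hab) (Nat.lcm_ne_zero hac hbc),
    Nat.factorization_gcd hab hc, Nat.factorization_lcm ha hb, Nat.factorization_lcm hac hbc,
    Nat.factorization_gcd ha hc, Nat.factorization_gcd hb hc]
  intro p
  simp only [Finsupp.inf_apply, Finsupp.sup_apply]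
  exact inf_sup_right _ _ _ |>.le

theorem Finset.gcd_lcm_dvd_of_forall_gcd_dvd {ι : Type*} {S : Finset ι} {n : ι → ℕ} {c : ℕ}
    (hn : ∀ t, 0 < n t) (hc : c ≠ 0) {z : ℤ} (h : ∀ t ∈ S, (Nat.gcd (n t) c : ℤ) ∣ z) :
    (Nat.gcd (S.lcm n) c : ℤ) ∣ z := by
  classical
  induction S using Finset.induction_on with
  | empty => simp
  | insert i S _ ih =>
    have hS : S.lcm n ≠ 0 := by
      simpa [Finset.lcm_eq_zero_iff] using fun t _ => (hn t).ne'
    rw [Finset.lcm_insert, Int.natCast_dvd]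
    refine (Nat.gcd_lcm_dvd_lcm_gcd (hn i).ne' hS hc).trans (Nat.lcm_dvd ?_ ?_)
    · exact Int.natCast_dvd.mp (h i (Finset.mem_insert_self i S))
    · exact Int.natCast_dvd.mp (ih fun t ht => h t (Finset.mem_insert_of_mem ht))

theorem Int.exists_modEq_and_modEq {a b : ℤ} {m n : ℕ} (h : (Nat.gcd m n : ℤ) ∣ b - a) :
    ∃ x : ℤ, x ≡ a [ZMOD (m : ℤ)] ∧ x ≡ b [ZMOD (n : ℤ)] := by
  obtain ⟨k, hk⟩ := h
  have hg := Nat.gcd_eq_gcd_ab m n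
  refine ⟨a + m * (m.gcdA n * k), ?_, ?_⟩
  · exact (Int.modEq_iff_dvd.mpr ⟨-(m.gcdA n * k), by ring⟩)
  · refine Int.modEq_iff_dvd.mpr ⟨m.gcdB n * k, ?_⟩
    rw [hg] at hk
    linear_combination hk

/-- A finite family of pairwise intersecting residue classes has a common element. -/
theorem Int.exists_forall_modEq_of_pairwise {ι : Type*} {S : Finset ι} {a : ι → ℤ} {n : ι → ℕ}
    (hn : ∀ t, 0 < n t)
    (h : (S : Set ι).Pairwise fun i j =>
      ∃ x : ℤ, x ≡ a i [ZMOD (n i : ℤ)] ∧ x ≡ a j [ZMOD (n j : ℤ)]) :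
    ∃ x : ℤ, ∀ t ∈ S, x ≡ a t [ZMOD (n t : ℤ)] := by
  classical
  induction S using Finset.induction_on with
  | empty => simp
  | insert i S hi ih =>
    obtain ⟨x, hx⟩ := ih (h.mono (by simp))
    have hdvd : (Nat.gcd (S.lcm n) (n i) : ℤ) ∣ a i - x := by
      refine Finset.gcd_lcm_dvd_of_forall_gcd_dvd hn (hn i).ne' fun t ht => ?_
      obtain ⟨y, hyt, hyi⟩ := h (Finset.mem_coe.2 (Finset.mem_insert_of_mem ht))
        (Finset.mem_coe.2 (Finset.mem_insert_self i S)) (by rintro rfl; exact hi ht)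
      have hl : (Nat.gcd (n t) (n i) : ℤ) ∣ n t := mod_cast Nat.gcd_dvd_left _ _
      have hr : (Nat.gcd (n t) (n i) : ℤ) ∣ n i := mod_cast Nat.gcd_dvd_right _ _
      exact (((hx t ht).trans hyt.symm).of_dvd hl |>.trans (hyi.of_dvd hr)).dvd
    obtain ⟨y, hyS, hyi⟩ := Int.exists_modEq_and_modEq hdvd
    refine ⟨y, fun t ht => ?_⟩
    rcases Finset.mem_insert.1 ht with rfl | ht
    · exact hyi
    · exact (hyS.of_dvd (mod_cast Finset.dvd_lcm ht)).trans (hx t ht)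

/-- If the graph `G` on `v₁, …, v_s` is an intersection graph of the
system of residue classes `𝒜 = {a_t (n_t)}_{t=1}^s`, then the clique number of `G`
equals the maximum value of the covering function `w_𝒜`. -/
theorem stmt8 (s : ℕ) (a : Fin s → ℤ) (n : Fin s → ℕ) (hn : ∀ t, 0 < n t)
    (G : SimpleGraph (Fin s))
    (hG : ∀ i j : Fin s, i < j →
      ((∃ x : ℤ, x ≡ a i [ZMOD (n i : ℤ)] ∧ x ≡ a j [ZMOD (n j : ℤ)]) ↔ G.Adj i j)) :
    IsGreatest (Set.range (coverFun a n Finset.univ)) G.cliqueNum := by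
  have hadj : ∀ i j : Fin s, i ≠ j →
      ((∃ x : ℤ, x ≡ a i [ZMOD (n i : ℤ)] ∧ x ≡ a j [ZMOD (n j : ℤ)]) ↔ G.Adj i j) := by
    intro i j hij
    rcases hij.lt_or_gt with hlt | hgt
    · exact hG i j hlt
    · rw [G.adj_comm, ← hG j i hgt]
      simp only [and_comm]
  have hle : ∀ x, coverFun a n Finset.univ x ≤ G.cliqueNum := fun x => by
    refine SimpleGraph.IsClique.card_le_cliqueNum (tc := ?_)
    intro i hi j hj hij
    simp only [Finset.coe_filter, Finset.mem_univ, true_and, Set.mem_ofPred_eq] at hi hj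
    exact (hadj i j hij).1 ⟨x, hi, hj⟩
  refine ⟨?_, by rintro _ ⟨x, rfl⟩; exact hle x⟩
  obtain ⟨S, hS⟩ := G.exists_isNClique_cliqueNum
  obtain ⟨x, hx⟩ := Int.exists_forall_modEq_of_pairwise (S := S) (a := a) hn
    fun i hi j hj hij => (hadj i j hij).2 (hS.isClique hi hj hij)
  refine ⟨x, (hle x).antisymm ?_⟩
  rw [← hS.card_eq]
  exact Finset.card_le_card fun t ht => Finset.mem_filter.2 ⟨Finset.mem_univ t, hx t ht⟩
end

section
/- For every positive integer m there exists a finite system 𝒜 = {a_t(n_t)}_{t=1}^{s} of residue classes with max{w_𝒜(x) : x ∈ ℤ} = m such that, for every partition of 𝒜 into two subsystems 𝒜₁ and 𝒜₂, one has max{ max_x w_{𝒜₁}(x), max_x w_{𝒜₂}(x) } = m. -/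
/-- `G.Arrows c a b`: in the colouring of the vertices by `c` and its complement there is an
`a`-clique inside `c` or a `b`-clique outside `c`. -/
def SimpleGraph.Arrows {V : Type*} (G : SimpleGraph V) (c : V → Prop) (a b : ℕ) : Prop :=
  (∃ Q : Finset V, G.IsNClique a Q ∧ ∀ v ∈ Q, c v) ∨
    ∃ Q : Finset V, G.IsNClique b Q ∧ ∀ v ∈ Q, ¬ c v

/-- Copies of `G` indexed by the embeddings `f` of `Finset V` into an independent set
`Finset V × Finset V`; in the copy `f`, every set `Q` of fewer than `m` vertices is joined
to the vertex `f Q` of the independent set. -/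
def SimpleGraph.attach {V : Type*} (G : SimpleGraph V) (m : ℕ) :
    SimpleGraph ((Finset V × Finset V) ⊕ ((Finset V ↪ Finset V × Finset V) × V)) where
  Adj
    | .inl _, .inl _ => False
    | .inl x, .inr p => ∃ Q : Finset V, p.1 Q = x ∧ p.2 ∈ Q ∧ Q.card < m
    | .inr p, .inl x => ∃ Q : Finset V, p.1 Q = x ∧ p.2 ∈ Q ∧ Q.card < m
    | .inr p, .inr q => p.1 = q.1 ∧ G.Adj p.2 q.2
  symm := ⟨by
    rintro (x | p) (y | q) h
    · exact h
    · exact h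
    · exact h
    · exact ⟨h.1.symm, h.2.symm⟩⟩
  loopless := ⟨by
    rintro (x | p) h
    · exact h
    · exact G.loopless.irrefl _ h.2⟩

theorem SimpleGraph.attach_cliqueFree {V : Type*} {G : SimpleGraph V} {m : ℕ} (hm : 0 < m)
    (hG : G.CliqueFree (m + 1)) : (G.attach m).CliqueFree (m + 1) := by
  classical
  intro K hK
  have hadj := hK.isClique
  have hcard := hK.card_eq
  by_cases hx : ∃ x, Sum.inl x ∈ K
  · obtain ⟨x, hx⟩ := hx
    have hpos : 0 < (K.erase (Sum.inl x)).card := by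
      rw [Finset.card_erase_of_mem hx]; omega
    obtain ⟨y | ⟨f, v⟩, hp⟩ := Finset.card_pos.1 hpos
    · rw [Finset.mem_erase] at hp
      exact hadj hx hp.2 hp.1.symm
    rw [Finset.mem_erase] at hp
    obtain ⟨Q, hQx, -, hQm⟩ := hadj hx hp.2 hp.1.symm
    have hsub : K.erase (Sum.inl x) ⊆ Q.image fun w => Sum.inr (f, w) := by
      rintro (y | ⟨g, w⟩) hq
      · rw [Finset.mem_erase] at hq
        exact (hadj hx hq.2 hq.1.symm).elim
      · rw [Finset.mem_erase] at hq
        have hfg : f = g := by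
          by_cases h : (Sum.inr (f, v) : (Finset V × Finset V) ⊕ _) = Sum.inr (g, w)
          · simp only [Sum.inr.injEq, Prod.mk.injEq] at h
            exact h.1
          · exact (hadj hp.2 hq.2 h).1
        subst hfg
        obtain ⟨Q', hQ', hw, -⟩ := hadj hx hq.2 hq.1.symm
        have : Q' = Q := f.injective (hQ'.trans hQx.symm)
        subst this
        exact Finset.mem_image.2 ⟨w, hw, rfl⟩
    have h1 := (Finset.card_le_card hsub).trans Finset.card_image_le
    rw [Finset.card_erase_of_mem hx] at h1
    omega
  · obtain ⟨y | ⟨f, v⟩, hp⟩ := Finset.card_pos.1 (show 0 < K.card by omega)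
    · exact hx ⟨y, hp⟩
    have hsub : ∀ q ∈ K, ∃ w, q = Sum.inr (f, w) := by
      rintro (y | ⟨g, w⟩) hq
      · exact (hx ⟨y, hq⟩).elim
      · by_cases h : (Sum.inr (f, v) : (Finset V × Finset V) ⊕ _) = Sum.inr (g, w)
        · exact ⟨v, h.symm⟩
        · obtain rfl : f = g := (hadj hp hq h).1
          exact ⟨w, rfl⟩
    have hinj : Function.Injective
        fun w : V => (Sum.inr (f, w) : (Finset V × Finset V) ⊕ (_ × V)) := by
      intro w w' h
      simpa using h
    refine hG (K.preimage _ hinj.injOn) ⟨?_, ?_⟩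
    · intro w hw w' hw' hne
      exact (hadj (Finset.mem_preimage.1 hw) (Finset.mem_preimage.1 hw')
        (fun h => hne (hinj h))).2
    · rw [Finset.card_preimage, Finset.filter_true_of_mem, hcard]
      intro q hq
      obtain ⟨w, rfl⟩ := hsub q hq
      exact ⟨w, rfl⟩

theorem SimpleGraph.exists_attach_isNClique {V : Type*} {G : SimpleGraph V} {m a : ℕ}
    (c : (Finset V × Finset V) ⊕ ((Finset V ↪ Finset V × Finset V) × V) → Prop)
    (f : Finset V ↪ Finset V × Finset V) {Q : Finset V}
    (hQ : G.IsNClique a Q) (hc : ∀ v ∈ Q, c (Sum.inr (f, v))) :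
    (∃ K, (G.attach m).IsNClique a K ∧ ∀ v ∈ K, c v) ∧
      (a < m → c (Sum.inl (f Q)) → ∃ K, (G.attach m).IsNClique (a + 1) K ∧ ∀ v ∈ K, c v) := by
  classical
  have hinj : Function.Injective
      fun w : V => (Sum.inr (f, w) : (Finset V × Finset V) ⊕ (_ × V)) := by
    intro w w' h
    simpa using h
  have hK : (G.attach m).IsNClique a (Q.image fun w => Sum.inr (f, w)) := by
    refine ⟨?_, by rw [Finset.card_image_of_injective _ hinj, hQ.card_eq]⟩
    intro p hp q hq hne
    obtain ⟨w, hw, rfl⟩ := Finset.mem_image.1 hp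
    obtain ⟨w', hw', rfl⟩ := Finset.mem_image.1 hq
    exact ⟨rfl, hQ.isClique hw hw' fun h => hne (by rw [h])⟩
  have hKc : ∀ p ∈ Q.image (fun w => Sum.inr (f, w)), c p := by
    intro p hp
    obtain ⟨w, hw, rfl⟩ := Finset.mem_image.1 hp
    exact hc w hw
  refine ⟨⟨_, hK, hKc⟩, fun ham hcx => ⟨_, hK.insert (a := Sum.inl (f Q)) ?_, ?_⟩⟩
  · intro p hp
    obtain ⟨w, hw, rfl⟩ := Finset.mem_image.1 hp
    exact ⟨Q, rfl, hw, hQ.card_eq.symm ▸ ham⟩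
  · intro p hp
    rcases Finset.mem_insert.1 hp with rfl | hp
    · exact hcx
    · exact hKc p hp

/-- In a two-colouring of `Y × Y`, one of the colours contains a copy of `Y`. -/
theorem exists_embedding_prod_monochromatic {Y : Type*} (c : Y × Y → Prop) :
    (∃ f : Y ↪ Y × Y, ∀ y, c (f y)) ∨ ∃ f : Y ↪ Y × Y, ∀ y, ¬ c (f y) := by
  by_cases h : ∀ y, ∃ z, c (y, z)
  · choose g hg using h
    exact .inl ⟨⟨fun y => (y, g y), fun y z h => (Prod.mk.inj h).1⟩, hg⟩
  · push Not at h
    obtain ⟨y, hy⟩ := h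
    exact .inr ⟨⟨fun z => (y, z), fun z w h => (Prod.mk.inj h).2⟩, hy⟩

/-- A vertex version of Folkman's theorem, in the form of an induction on `a + b`. -/
theorem exists_cliqueFree_arrows_of_add_le {m : ℕ} (hm : 0 < m) (k : ℕ) :
    ∃ (V : Type) (_ : Finite V) (G : SimpleGraph V), G.CliqueFree (m + 1) ∧
      ∀ c a b, a ≤ m → b ≤ m → a + b ≤ k → G.Arrows c a b := by
  induction k with
  | zero =>
    refine ⟨Empty, inferInstance, ⊥, ?_, fun c a b _ _ h => .inl ⟨∅, ?_, by simp⟩⟩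
    · intro K hK
      have := hK.card_eq
      rw [Finset.eq_empty_of_isEmpty K] at this
      simp at this
    · obtain rfl : a = 0 := by omega
      simp
  | succ k ih =>
    obtain ⟨V, _, G, hG, harr⟩ := ih
    refine ⟨_, ?_, G.attach m, SimpleGraph.attach_cliqueFree hm hG, ?_⟩
    · have : Finite (Finset V ↪ Finset V × Finset V) := DFunLike.finite _
      infer_instance
    intro c a b ha hb hab
    rcases a with _ | a
    · exact .inl ⟨∅, by simp, by simp⟩
    rcases b with _ | b
    · exact .inr ⟨∅, by simp, by simp⟩
    rcases exists_embedding_prod_monochromatic fun x => c (Sum.inl x) with ⟨f, hf⟩ | ⟨f, hf⟩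
    · rcases harr (fun v => c (Sum.inr (f, v))) a (b + 1) (by omega) hb (by omega)
        with ⟨Q, hQ, hc⟩ | ⟨Q, hQ, hc⟩
      · exact .inl ((SimpleGraph.exists_attach_isNClique c f hQ hc).2 ha (hf Q))
      · exact .inr (SimpleGraph.exists_attach_isNClique (fun v => ¬ c v) f hQ hc).1
    · rcases harr (fun v => c (Sum.inr (f, v))) (a + 1) b ha (by omega) (by omega)
        with ⟨Q, hQ, hc⟩ | ⟨Q, hQ, hc⟩
      · exact .inl (SimpleGraph.exists_attach_isNClique c f hQ hc).1
      · exact .inr ((SimpleGraph.exists_attach_isNClique (fun v => ¬ c v) f hQ hc).2 hb (hf Q))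

theorem exists_fin_cliqueFree_arrows {m : ℕ} (hm : 0 < m) :
    ∃ (s : ℕ) (G : SimpleGraph (Fin s)), G.CliqueFree (m + 1) ∧ ∀ c, G.Arrows c m m := by
  obtain ⟨V, _, G, hG, harr⟩ := exists_cliqueFree_arrows_of_add_le hm (m + m)
  obtain ⟨s, ⟨e⟩⟩ := Finite.exists_equiv_fin V
  have hclique : ∀ {n Q}, G.IsNClique n Q →
      (G.map e.toEmbedding).IsNClique n (Q.map e.toEmbedding) := fun h => h.map
  refine ⟨s, G.map e.toEmbedding, hG.comap ⟨(SimpleGraph.Iso.map e G).symm.toCopy⟩, fun c => ?_⟩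
  rcases harr (fun v => c (e v)) m m le_rfl le_rfl le_rfl with ⟨Q, hQ, hc⟩ | ⟨Q, hQ, hc⟩
  · exact .inl ⟨_, hclique hQ, Finset.forall_mem_map.2 hc⟩
  · exact .inr ⟨_, hclique hQ, Finset.forall_mem_map.2 hc⟩

/-- Every finite graph is the intersection graph of a system of residue classes with the
Helly property. -/
theorem SimpleGraph.exists_residue_system {V : Type*} [Finite V] (G : SimpleGraph V) :
    ∃ (a : V → ℤ) (n : V → ℕ), (∀ t, 0 < n t) ∧
      (∀ x : ℤ, G.IsClique {t | x ≡ a t [ZMOD (n t : ℤ)]}) ∧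
      ∀ K : Set V, G.IsClique K → ∃ x : ℤ, ∀ t ∈ K, x ≡ a t [ZMOD (n t : ℤ)] := by
  classical
  have := Fintype.ofFinite V
  obtain ⟨e, he⟩ := exists_injective_nat (V × V)
  let p : V × V → ℕ := fun q => Nat.nth Nat.Prime (e q)
  have hp : ∀ q, (p q).Prime := fun q => Nat.prime_nth_prime _
  have hcop : Pairwise (Function.onFun Nat.Coprime p) := fun q r hqr =>
    (Nat.coprime_primes (hp q) (hp r)).2 fun h =>
      hqr (he (Nat.nth_injective Nat.infinite_setOfPred_prime h))
  have crt : ∀ P : V × V → Prop, ∃ x : ℤ, ∀ q, x ≡ (if P q then 0 else 1) [ZMOD (p q : ℤ)] := by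
    intro P
    obtain ⟨k, hk⟩ := Nat.chineseRemainderOfFinset (fun q => if P q then 0 else 1) p
      Finset.univ (fun q _ => (hp q).ne_zero) (fun q _ r _ h => hcop h)
    refine ⟨k, fun q => ?_⟩
    have := (Int.natCast_modEq_iff (a := k) (n := p q)).2 (hk q (Finset.mem_univ q))
    simpa using this
  choose a ha using fun t : V => crt fun q => q.1 = t
  let B : V → Finset (V × V) := fun t =>
    Finset.univ.filter fun q => q.1 ≠ q.2 ∧ ¬ G.Adj q.1 q.2 ∧ (q.1 = t ∨ q.2 = t)
  have key : ∀ x t, x ≡ a t [ZMOD ((∏ q ∈ B t, p q : ℕ) : ℤ)] ↔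
      ∀ q ∈ B t, x ≡ (if q.1 = t then 0 else 1) [ZMOD (p q : ℤ)] := by
    intro x t
    have h1 : x ≡ a t [ZMOD ((∏ q ∈ B t, p q : ℕ) : ℤ)] ↔
        ∀ q ∈ B t, x ≡ a t [ZMOD (p q : ℤ)] := by
      simp only [Int.modEq_iff_dvd, Nat.cast_prod]
      refine ⟨fun h q hq => (Finset.dvd_prod_of_mem _ hq).trans h, fun h => ?_⟩
      exact Finset.prod_dvd_of_coprime
        (fun q _ r _ hqr => Nat.isCoprime_iff_coprime.2 (hcop hqr)) h
    rw [h1]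
    exact forall₂_congr fun q _ => ⟨fun h => h.trans (ha t q), fun h => h.trans (ha t q).symm⟩
  refine ⟨a, fun t => ∏ q ∈ B t, p q, fun t => Finset.prod_pos fun q _ => (hp q).pos, ?_, ?_⟩
  · intro x t ht u hu htu
    by_contra hadj
    have h0 := (key x t).1 ht (t, u) (by simp [B, htu, hadj])
    have h1 := (key x u).1 hu (t, u) (by simp [B, htu, hadj])
    simp only [if_true, if_neg htu] at h0 h1
    have h2 := Int.modEq_iff_dvd.1 (h0.symm.trans h1)
    refine (hp (t, u)).one_lt.ne' (Nat.dvd_one.1 ?_)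
    rw [sub_zero] at h2
    exact_mod_cast h2
  · intro K hK
    obtain ⟨x, hx⟩ := crt fun q => q.1 ∈ K
    refine ⟨x, fun t ht => (key x t).2 fun q hq => ?_⟩
    have hxq := hx q
    simp only [B, Finset.mem_filter, Finset.mem_univ, true_and] at hq
    obtain ⟨hne, hadj, rfl | rfl⟩ := hq
    · simpa [ht] using hxq
    · have : q.1 ∉ K := fun h => hadj (hK h ht hne)
      simpa [this, hne] using hxq

/-- For every positive integer `m` there is a finite system
`𝒜 = {a_t (n_t)}_{t=1}^s` of residue classes with `max_x w_𝒜(x) = m` such that for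
every partition of `𝒜` into two subsystems `𝒜₁ = {a_t(n_t) : t ∈ I}` and
`𝒜₂ = {a_t(n_t) : t ∉ I}` one has `max (max_x w_{𝒜₁}(x)) (max_x w_{𝒜₂}(x)) = m`. -/
theorem stmt9 (m : ℕ) (hm : 0 < m) :
    ∃ (s : ℕ) (a : Fin s → ℤ) (n : Fin s → ℕ),
      (∀ t, 0 < n t) ∧
      IsGreatest (Set.range (coverFun a n Finset.univ)) m ∧
      ∀ I : Finset (Fin s),
        max (sSup (Set.range (coverFun a n I))) (sSup (Set.range (coverFun a n Iᶜ))) = m := by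
  obtain ⟨s, G, hG, harr⟩ := exists_fin_cliqueFree_arrows hm
  obtain ⟨a, n, hn, hclique, hhelly⟩ := G.exists_residue_system
  have hle : ∀ I x, coverFun a n I x ≤ m := by
    intro I x
    by_contra! hlt
    refine hG.mono hlt _ ⟨(hclique x).subset ?_, rfl⟩
    intro t ht
    exact (Finset.mem_filter.1 ht).2
  have hge : ∀ (I Q : Finset (Fin s)), G.IsNClique m Q → Q ⊆ I →
      ∃ x, coverFun a n I x = m := by
    intro I Q hQ hQI
    obtain ⟨x, hx⟩ := hhelly _ hQ.isClique
    refine ⟨x, (hle I x).antisymm ?_⟩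
    rw [← hQ.card_eq]
    exact Finset.card_le_card fun t ht => Finset.mem_filter.2 ⟨hQI ht, hx t ht⟩
  have hmax : ∀ (I Q : Finset (Fin s)), G.IsNClique m Q → Q ⊆ I →
      IsGreatest (Set.range (coverFun a n I)) m := fun I Q hQ hQI =>
    ⟨hge I Q hQ hQI, Set.forall_mem_range.2 (hle I)⟩
  have hsup : ∀ I, sSup (Set.range (coverFun a n I)) ≤ m := fun I =>
    csSup_le (Set.range_nonempty _) (Set.forall_mem_range.2 (hle I))
  refine ⟨s, a, n, hn, ?_, fun I => ?_⟩
  · rcases harr fun _ => True with ⟨Q, hQ, -⟩ | ⟨Q, hQ, -⟩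
    all_goals exact hmax _ Q hQ (Finset.subset_univ Q)
  · rcases harr (· ∈ I) with ⟨Q, hQ, hQI⟩ | ⟨Q, hQ, hQI⟩
    · rw [(hmax I Q hQ hQI).csSup_eq, max_eq_left (hsup _)]
    · rw [(hmax Iᶜ Q hQ fun t ht => Finset.mem_compl.2 (hQI t ht)).csSup_eq,
        max_eq_right (hsup _)]
end

section
/- For every integer m ≥ 2 there exists an exact m-cover ℬ = {a_t(n_t)}_{t=1}^{s} of ℤ which is not the union of two 1-covers: for every partition of ℬ into two subsystems ℬ₁ and ℬ₂, at least one of ℬ₁, ℬ₂ fails to be a 1-cover of ℤ, i.e., there exists an integer x with w_{ℬ₁}(x) = 0 or an integer x with w_{ℬ₂}(x) = 0. -/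
/-- Every two-colouring of `W × W` has a monochromatic set equinumerous with `W`. -/
theorem exists_embedding_prod_monochromatic_s11 {W : Type} (c : W × W → Bool) :
    ∃ (φ : W ↪ W × W) (b : Bool), ∀ w, c (φ w) = b := by
  by_cases h : ∃ w, ∀ w', c (w, w') = false
  · obtain ⟨w, hw⟩ := h
    exact ⟨⟨fun w' => (w, w'), fun x y hxy => (Prod.mk.inj hxy).2⟩, false, hw⟩
  · push Not at h
    choose g hg using h
    exact ⟨⟨fun w => (w, g w), fun x y hxy => (Prod.mk.inj hxy).1⟩, true,
      fun w => Bool.eq_true_of_not_eq_false (hg w)⟩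

/-- A graph is `n`-clique-free iff no family indexed by `Fin n` has pairwise adjacent members. -/
theorem SimpleGraph.cliqueFree_iff_forall_fin {V : Type} {G : SimpleGraph V} {n : ℕ} :
    G.CliqueFree n ↔ ¬ ∃ f : Fin n → V, ∀ i j, i ≠ j → G.Adj (f i) (f j) := by
  rw [← not_iff_not, not_not, SimpleGraph.not_cliqueFree_iff_top_isContained]
  constructor
  · rintro ⟨f⟩
    exact ⟨f, fun i j hij => f.toHom.map_adj hij⟩
  · rintro ⟨f, hf⟩
    refine ⟨⟨⟨f, fun {i j} hij => hf i j hij⟩, fun i j hij => ?_⟩⟩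
    by_contra hne
    exact (hf i j hne).ne hij

section Amalgamation

variable {V T : Type} (G : SimpleGraph V) (π : V → T) (i : T)

/-- The part of `V` lying over `i`. -/
abbrev PartOver : Type := {v : V // π v = i}

/-- The vertex set of the amalgamation of copies of `V` along the part over `i`. -/
abbrev AmalgamVertex : Type :=
  (PartOver π i × PartOver π i) ⊕
    ((PartOver π i ↪ PartOver π i × PartOver π i) × {v : V // π v ≠ i})

variable {i} in
open Classical in
/-- The copy of `V` in the amalgamation whose part over `i` is embedded by `φ`. -/
noncomputable def amalgamCopy (φ : PartOver π i ↪ PartOver π i × PartOver π i) (v : V) :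
    AmalgamVertex π i :=
  if h : π v = i then Sum.inl (φ ⟨v, h⟩) else Sum.inr (φ, ⟨v, h⟩)

/-- The projection of the amalgamation to the set of parts. -/
def amalgamPart : AmalgamVertex π i → T :=
  Sum.elim (fun _ => i) fun x => π x.2

variable {i}

theorem amalgamCopy_injective (φ : PartOver π i ↪ PartOver π i × PartOver π i) :
    Function.Injective (amalgamCopy π φ) := by
  intro u v h
  unfold amalgamCopy at h
  split_ifs at h with h1 h2 h2
  · simpa using h
  · simpa using h

theorem amalgamPart_copy (φ : PartOver π i ↪ PartOver π i × PartOver π i) (v : V) :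
    amalgamPart π i (amalgamCopy π φ v) = π v := by
  unfold amalgamCopy amalgamPart
  split_ifs with h
  · simp [h]
  · simp

theorem eq_of_amalgamCopy_eq {φ ψ : PartOver π i ↪ PartOver π i × PartOver π i} {u v : V}
    (h : amalgamCopy π φ u = amalgamCopy π ψ v) (hu : π u ≠ i) : φ = ψ := by
  have hv : π v ≠ i := by
    rwa [← amalgamPart_copy π ψ v, ← h, amalgamPart_copy]
  simp only [amalgamCopy, dif_neg hu, dif_neg hv] at h
  exact (Prod.mk.inj (Sum.inr.inj h)).1

variable (i) in
/-- The amalgamation of copies of `G` along the part over `i`, one for each embedding of this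
part into its square. -/
def amalgam : SimpleGraph (AmalgamVertex π i) where
  Adj x y := ∃ φ u v, G.Adj u v ∧ amalgamCopy π φ u = x ∧ amalgamCopy π φ v = y
  symm := ⟨fun _ _ ⟨φ, u, v, h, hx, hy⟩ => ⟨φ, v, u, h.symm, hy, hx⟩⟩
  loopless := ⟨fun _ ⟨φ, _, _, h, hx, hy⟩ =>
    h.ne (amalgamCopy_injective π φ (hx.trans hy.symm))⟩

variable {G π}

theorem amalgam_proper (hπ : ∀ u v, G.Adj u v → π u ≠ π v) (x y : AmalgamVertex π i)
    (h : (amalgam G π i).Adj x y) : amalgamPart π i x ≠ amalgamPart π i y := by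
  obtain ⟨φ, u, v, h, rfl, rfl⟩ := h
  simpa only [amalgamPart_copy] using hπ u v h

/-- Amalgamating along an independent part creates no new cliques. -/
theorem amalgam_cliqueFree (hπ : ∀ u v, G.Adj u v → π u ≠ π v) {n : ℕ}
    (hG : G.CliqueFree (n + 2)) : (amalgam G π i).CliqueFree (n + 2) := by
  rw [SimpleGraph.cliqueFree_iff_forall_fin] at hG ⊢
  rintro ⟨f, hf⟩
  apply hG
  obtain ⟨k, hk⟩ : ∃ k, amalgamPart π i (f k) ≠ i := by
    by_contra! h
    exact amalgam_proper hπ _ _ (hf 0 1 (by simp)) ((h 0).trans (h 1).symm)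
  obtain ⟨l, hl⟩ : ∃ l, k ≠ l := (exists_ne k).imp fun _ h => h.symm
  obtain ⟨φ, u, -, -, hu, -⟩ := hf k l hl
  have hui : π u ≠ i := by rwa [← amalgamPart_copy π φ u, hu]
  have hcopy : ∀ j, ∃ v, amalgamCopy π φ v = f j := by
    intro j
    by_cases hj : k = j
    · exact ⟨u, hj ▸ hu⟩
    obtain ⟨ψ, u', v, -, hu', hv⟩ := hf k j hj
    obtain rfl := eq_of_amalgamCopy_eq π (hu.trans hu'.symm) hui
    exact ⟨v, hv⟩
  choose g hg using hcopy
  refine ⟨g, fun a b hab => ?_⟩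
  obtain ⟨ψ, a', b', hadj, ha, hb⟩ := hf a b hab
  have hφ : φ = ψ := by
    by_cases h : π (g a) = i
    · refine eq_of_amalgamCopy_eq π ((hg b).trans hb.symm) fun h' => ?_
      apply amalgam_proper hπ _ _ (hf a b hab)
      rw [← hg a, ← hg b, amalgamPart_copy, amalgamPart_copy, h, h']
    · exact eq_of_amalgamCopy_eq π ((hg a).trans ha.symm) h
  subst hφ
  rwa [← amalgamCopy_injective π φ (ha.trans (hg a).symm),
    ← amalgamCopy_injective π φ (hb.trans (hg b).symm)]

end Amalgamation

/-- The partite construction: any partite graph `G₀` embeds in every two-coloured large partite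
graph with the same clique bound so that its parts in `S` are monochromatic. -/
theorem exists_partite_monochromatic_parts {V₀ T : Type} [Finite V₀] (G₀ : SimpleGraph V₀)
    (π₀ : V₀ → T) (hπ₀ : ∀ u v, G₀.Adj u v → π₀ u ≠ π₀ v) {n : ℕ}
    (hG₀ : G₀.CliqueFree (n + 2)) (S : Finset T) :
    ∃ (V : Type) (_ : Finite V) (G : SimpleGraph V) (π : V → T),
      (∀ u v, G.Adj u v → π u ≠ π v) ∧ G.CliqueFree (n + 2) ∧
      ∀ c : V → Bool, ∃ f : V₀ → V, (∀ u v, G₀.Adj u v → G.Adj (f u) (f v)) ∧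
        (∀ u, π (f u) = π₀ u) ∧ ∀ t ∈ S, ∃ b, ∀ u, π₀ u = t → c (f u) = b := by
  classical
  induction S using Finset.induction with
  | empty =>
    exact ⟨V₀, inferInstance, G₀, π₀, hπ₀, hG₀, fun c => ⟨id, fun _ _ h => h, fun _ => rfl,
      by simp⟩⟩
  | insert i S _ ih =>
    obtain ⟨V, _, G, π, hπ, hG, h⟩ := ih
    refine ⟨AmalgamVertex π i, inferInstance, amalgam G π i, amalgamPart π i, amalgam_proper hπ,
      amalgam_cliqueFree hπ hG, fun c => ?_⟩
    obtain ⟨φ, b, hb⟩ := exists_embedding_prod_monochromatic_s11 fun x => c (Sum.inl x)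
    obtain ⟨f, hf, hfπ, hfc⟩ := h (c ∘ amalgamCopy π φ)
    refine ⟨amalgamCopy π φ ∘ f, fun u v huv => ⟨φ, _, _, hf u v huv, rfl, rfl⟩,
      fun u => (amalgamPart_copy π φ _).trans (hfπ u), fun t ht => ?_⟩
    rcases Finset.mem_insert.1 ht with rfl | ht
    · refine ⟨b, fun u hu => ?_⟩
      have hu' : π (f u) = t := (hfπ u).trans hu
      simp only [Function.comp, amalgamCopy, dif_pos hu']
      exact hb _
    · exact hfc t ht

/-- Folkman's theorem for vertex colourings and complete graphs: there is a finite graph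
without cliques of size `m + 1` in which every two-colouring of the vertices has a
monochromatic clique of size `m`. -/
theorem exists_cliqueFree_monochromatic_clique (m : ℕ) (hm : 1 ≤ m) :
    ∃ (V : Type) (_ : Finite V) (G : SimpleGraph V), G.CliqueFree (m + 1) ∧
      ∀ c : V → Bool, ∃ (s : Finset V) (b : Bool), G.IsNClique m s ∧ ∀ v ∈ s, c v = b := by
  obtain ⟨n, rfl⟩ := Nat.exists_eq_add_of_le' hm
  let W := Fin (n + 1)
  let G₀ : SimpleGraph ((W ↪ W × W) × W) :=
    { Adj := fun x y => x.1 = y.1 ∧ x.2 ≠ y.2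
      symm := ⟨fun _ _ h => ⟨h.1.symm, h.2.symm⟩⟩
      loopless := ⟨fun _ h => h.2 rfl⟩ }
  have hG₀ : G₀.CliqueFree (n + 2) := by
    rw [SimpleGraph.cliqueFree_iff_forall_fin]
    rintro ⟨f, hf⟩
    obtain ⟨i, j, hij, h⟩ := Fintype.exists_ne_map_eq_of_card_lt (fun i => (f i).2) (by simp [W])
    exact (hf i j hij).2 h
  obtain ⟨V, hV, G, π, -, hG, h⟩ := exists_partite_monochromatic_parts G₀
    (fun x => x.1 x.2) (by
      rintro ⟨e, k⟩ ⟨e', k'⟩ ⟨h, hk⟩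
      obtain rfl : e = e' := h
      exact fun h => hk (e.injective h)) hG₀ Finset.univ
  refine ⟨V, hV, G, hG, fun c => ?_⟩
  obtain ⟨f, hf, -, hfc⟩ := h c
  choose d hd using fun t => hfc t (Finset.mem_univ t)
  obtain ⟨e, b, hb⟩ := exists_embedding_prod_monochromatic_s11 d
  have hadj : ∀ k l, k ≠ l → G.Adj (f (e, k)) (f (e, l)) := fun k l hkl => hf _ _ ⟨rfl, hkl⟩
  have hinj : Function.Injective fun k => f (e, k) := by
    intro k l hkl
    by_contra hne
    exact (hadj k l hne).ne hkl
  refine ⟨Finset.univ.map ⟨_, hinj⟩, b, ⟨?_, by simp [W]⟩, ?_⟩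
  · intro x hx y hy hxy
    simp only [Finset.coe_map, Finset.coe_univ, Set.image_univ, Set.mem_range,
      Function.Embedding.coeFn_mk] at hx hy
    obtain ⟨k, rfl⟩ := hx
    obtain ⟨l, rfl⟩ := hy
    exact hadj k l fun h => hxy (h ▸ rfl)
  · intro v hv
    obtain ⟨k, -, rfl⟩ := Finset.mem_map.1 hv
    exact (hd (e k) (e, k) rfl).trans (hb k)

/-- The Chinese remainder theorem: simultaneous congruences to pairwise coprime moduli define a
residue class modulo their product. -/
theorem exists_modEq_prod_iff {ι : Type} (p : ι → ℕ) (hp : Pairwise fun i j => (p i).Coprime (p j))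
    (hp0 : ∀ i, p i ≠ 0) (S : Finset ι) (r : ι → ℕ) :
    ∃ a : ℤ, ∀ x : ℤ, x ≡ a [ZMOD ((∏ i ∈ S, p i : ℕ) : ℤ)] ↔ ∀ i ∈ S, x ≡ r i [ZMOD p i] := by
  obtain ⟨a, ha⟩ := Nat.chineseRemainderOfFinset r p S (fun i _ => hp0 i)
    (fun i _ j _ hij => hp hij)
  have ha' : ∀ i ∈ S, (a : ℤ) ≡ r i [ZMOD p i] := fun i hi => (Int.natCast_modEq_iff).2 (ha i hi)
  refine ⟨a, fun x => ⟨fun h i hi => ?_, fun h => ?_⟩⟩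
  · exact (h.of_dvd (Int.natCast_dvd_natCast.2 (Finset.dvd_prod_of_mem p hi))).trans (ha' i hi)
  · rw [Int.modEq_iff_dvd, Nat.cast_prod]
    refine Finset.prod_dvd_of_coprime (fun i _ j _ hij => ?_) fun i hi => ?_
    · exact Nat.isCoprime_iff_coprime.2 (hp hij)
    · exact Int.modEq_iff_dvd.1 ((h i hi).trans (ha' i hi).symm)

/-- A finite graph is realized by residue classes, in such a way that the classes through an
integer form a clique and the classes of a clique have a common element. -/
theorem exists_residueClasses_of_graph {V : Type} [Finite V] (G : SimpleGraph V) :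
    ∃ (a : V → ℤ) (n : V → ℕ), (∀ v, 0 < n v) ∧
      (∀ x : ℤ, G.IsClique {v | x ≡ a v [ZMOD n v]}) ∧
      ∀ s : Set V, G.IsClique s → ∃ x : ℤ, ∀ v ∈ s, x ≡ a v [ZMOD n v] := by
  classical
  have := Fintype.ofFinite V
  obtain ⟨q, hq⟩ := Countable.exists_injective_nat (V × V)
  let p : V × V → ℕ := fun e => Nat.nth Nat.Prime (q e)
  have hprime : ∀ e, (p e).Prime := fun e => Nat.prime_nth_prime _
  have hp : Pairwise fun e e' => (p e).Coprime (p e') := fun e e' h =>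
    (Nat.coprime_primes (hprime e) (hprime e')).2 fun h' =>
      h (hq (Nat.nth_injective Nat.infinite_setOfPred_prime h'))
  let S : V → Finset (V × V) := fun v =>
    Finset.univ.filter fun e => e.1 ≠ e.2 ∧ ¬ G.Adj e.1 e.2 ∧ (e.1 = v ∨ e.2 = v)
  choose a ha using fun v => exists_modEq_prod_iff p hp (fun e => (hprime e).ne_zero) (S v)
    fun e => if e.2 = v then 1 else 0
  refine ⟨a, fun v => ∏ e ∈ S v, p e, fun v => Finset.prod_pos fun e _ => (hprime e).pos,
    fun x u hu v hv huv => ?_, fun s hs => ?_⟩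
  · by_contra hadj
    have h0 := (ha u x).1 hu (u, v) (by simp [S, huv, hadj])
    have h1 := (ha v x).1 hv (u, v) (by simp [S, huv, hadj])
    have h01 := h0.symm.trans h1
    rw [if_neg huv.symm, if_pos rfl, Int.natCast_modEq_iff] at h01
    exact (hprime (u, v)).one_lt.ne' ((Nat.modEq_zero_iff_dvd.1 h01.symm) |> Nat.dvd_one.1)
  · obtain ⟨x, hx⟩ := exists_modEq_prod_iff p hp (fun e => (hprime e).ne_zero) Finset.univ
      fun e => if e.2 ∈ s then 1 else 0
    refine ⟨x, fun v hv => (ha v x).2 fun e he => ?_⟩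
    have hxe := (hx x).1 rfl e (Finset.mem_univ e)
    obtain ⟨-, hne, hadj, h⟩ := Finset.mem_filter.1 he
    convert hxe using 4
    refine ⟨fun h2 => h2 ▸ hv, fun h2 => ?_⟩
    rcases h with h1 | hev
    · exact absurd (hs (h1 ▸ hv) h2 hne) hadj
    · exact hev

/-- A finite system of residue classes covering no integer more than `m` times extends to an
exact `m`-cover by classes that avoid every integer already covered `m` times. -/
theorem exists_exact_cover_extension {V : Type} [Fintype V] (a : V → ℤ) (n : V → ℕ)
    (hn : ∀ v, 0 < n v) (m : ℕ)
    (hm : ∀ x : ℤ, (Finset.univ.filter fun v => x ≡ a v [ZMOD n v]).card ≤ m) :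
    ∃ (κ : Type) (_ : Fintype κ) (b : κ → ℤ) (l : κ → ℕ), (∀ k, 0 < l k) ∧
      ∀ x : ℤ, (Finset.univ.filter fun v => x ≡ a v [ZMOD n v]).card +
        (Finset.univ.filter fun k => x ≡ b k [ZMOD l k]).card = m := by
  classical
  let N := ∏ v, n v
  have hN : 0 < N := Finset.prod_pos fun v _ => hn v
  let w : ℤ → ℕ := fun x => (Finset.univ.filter fun v => x ≡ a v [ZMOD n v]).card
  have hw : ∀ x y : ℤ, x ≡ y [ZMOD N] → w x = w y := by
    intro x y hxy
    refine congrArg Finset.card (Finset.filter_congr fun v _ => ?_)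
    have h : x ≡ y [ZMOD n v] :=
      hxy.of_dvd (Int.natCast_dvd_natCast.2 (Finset.dvd_prod_of_mem n (Finset.mem_univ v)))
    exact ⟨h.symm.trans, h.trans⟩
  refine ⟨Σ r : Fin N, Fin (m - w (r : ℕ)), inferInstance, fun k => (k.1 : ℕ), fun _ => N,
    fun _ => hN, fun x => ?_⟩
  have hx0 : 0 ≤ x % N := Int.emod_nonneg _ (by exact_mod_cast hN.ne')
  have hxN : x % N < N := Int.emod_lt_of_pos _ (by exact_mod_cast hN)
  let r : Fin N := ⟨(x % N).toNat, by omega⟩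
  have hr : ((r : ℕ) : ℤ) = x % N := Int.toNat_of_nonneg hx0
  have hfilter : (Finset.univ.filter fun k : Σ r : Fin N, Fin (m - w (r : ℕ)) =>
      x ≡ ((k.1 : ℕ) : ℤ) [ZMOD N]) = Finset.univ.map (Function.Embedding.sigmaMk r) := by
    ext ⟨r', j⟩
    simp only [Finset.mem_filter, Finset.mem_univ, true_and, Finset.mem_map,
      Function.Embedding.sigmaMk_apply]
    constructor
    · intro h
      have hr' : r = r' := by
        apply Fin.ext
        have h2 : ((r' : ℕ) : ℤ) % N = (r' : ℕ) :=
          Int.emod_eq_of_lt (by positivity) (by exact_mod_cast r'.2)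
        have h3 : x % N = ((r' : ℕ) : ℤ) % N := h
        omega
      subst hr'
      exact ⟨j, rfl⟩
    · rintro ⟨j', hj⟩
      obtain rfl : r = r' := congrArg Sigma.fst hj
      rw [hr]
      exact (Int.mod_modEq x N).symm
  have hwr : w (r : ℕ) = w x := hw _ _ (by rw [hr]; exact Int.mod_modEq x N)
  rw [hfilter, Finset.card_map, Finset.card_univ, Fintype.card_fin, hwr]
  exact Nat.add_sub_cancel' (hm x)

/-- For every `m ≥ 2` there exists an exact `m`-cover
`ℬ = {a_t (n_t)}_{t=1}^s` of `ℤ` which is not the union of two `1`-covers: for every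
partition of `ℬ` into subsystems `ℬ₁ = {a_t(n_t) : t ∈ I}` and
`ℬ₂ = {a_t(n_t) : t ∉ I}`, one of `ℬ₁, ℬ₂` misses some integer. -/
theorem stmt11 (m : ℕ) (hm : 2 ≤ m) :
    ∃ (s : ℕ) (a : Fin s → ℤ) (n : Fin s → ℕ),
      (∀ t, 0 < n t) ∧
      (∀ x : ℤ, coverFun a n Finset.univ x = m) ∧
      ∀ I : Finset (Fin s),
        (∃ x : ℤ, coverFun a n I x = 0) ∨ (∃ x : ℤ, coverFun a n Iᶜ x = 0) := by
  classical
  obtain ⟨V, _, G, hfree, hG⟩ := exists_cliqueFree_monochromatic_clique m (by omega)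
  have := Fintype.ofFinite V
  obtain ⟨a, n, hn, hclique, hpoint⟩ := exists_residueClasses_of_graph G
  have hle : ∀ x : ℤ, (Finset.univ.filter fun v => x ≡ a v [ZMOD n v]).card ≤ m := by
    intro x
    by_contra! h
    obtain ⟨s, hs, hcard⟩ := Finset.exists_subset_card_eq h
    exact hfree s ⟨(hclique x).subset fun v hv => (Finset.mem_filter.1 (hs hv)).2, hcard⟩
  obtain ⟨κ, _, b, l, hl, hbl⟩ := exists_exact_cover_extension a n hn m hle
  let e := (Fintype.equivFin (V ⊕ κ)).symm
  let a' : V ⊕ κ → ℤ := Sum.elim a b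
  let n' : V ⊕ κ → ℕ := Sum.elim n l
  refine ⟨Fintype.card (V ⊕ κ), a' ∘ e, n' ∘ e, fun t => ?_, fun x => ?_, fun I => ?_⟩
  · rcases h : e t with v | k
    · simpa [n', h] using hn v
    · simpa [n', h] using hl k
  · rw [← hbl x]
    unfold coverFun
    simp only [Finset.card_filter, Function.comp]
    rw [e.sum_comp fun t => if x ≡ a' t [ZMOD n' t] then 1 else 0, Fintype.sum_sum_type]
    rfl
  · obtain ⟨s, β, hs, hβ⟩ := hG fun v => decide (e.symm (Sum.inl v) ∈ I)
    obtain ⟨x, hx⟩ := hpoint s hs.isClique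
    have hsub : s ⊆ Finset.univ.filter fun v => x ≡ a v [ZMOD n v] := fun v hv =>
      Finset.mem_filter.2 ⟨Finset.mem_univ v, hx v hv⟩
    have heq := Finset.eq_of_subset_of_card_le hsub ((hle x).trans hs.card_eq.ge)
    have hκ : (Finset.univ.filter fun k => x ≡ b k [ZMOD l k]) = ∅ := by
      have h := hbl x
      rw [← heq, hs.card_eq] at h
      exact Finset.card_eq_zero.1 (by omega)
    have hmem : ∀ t, x ≡ (a' ∘ e) t [ZMOD ((n' ∘ e) t : ℕ)] → decide (t ∈ I) = β := by
      intro t ht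
      rcases h : e t with v | k
      · have hv : v ∈ s := by
          rw [heq]
          simpa [a', n', h] using ht
        rw [← hβ v hv, ← h, e.symm_apply_apply]
      · have hk : k ∈ (Finset.univ.filter fun k => x ≡ b k [ZMOD l k]) := by
          simpa [a', n', h] using ht
        simp [hκ] at hk
    cases β
    · refine Or.inl ⟨x, Finset.card_eq_zero.2 (Finset.filter_eq_empty_iff.2 fun t ht h => ?_)⟩
      exact of_decide_eq_false (hmem t h) ht
    · refine Or.inr ⟨x, Finset.card_eq_zero.2 (Finset.filter_eq_empty_iff.2 fun t ht h => ?_)⟩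
      exact Finset.mem_compl.1 ht (of_decide_eq_true (hmem t h))
end

section
/- Let G = (V, E) be a finite simple graph having at least one edge, and let l(G) denote the length (number of edges) of a longest path in G. Then there exists a partition of the vertex set V into two sets V₁ and V₂ such that V₂ is an independent set of G and every path in the induced subgraph G[V₁] has length strictly less than l(G). -/
/-- In a finite graph there is an independent set that meets the neighbourhood of every vertex
outside it. -/
theorem SimpleGraph.exists_isIndepSet_dominating {V : Type*} [Finite V] (G : SimpleGraph V) :
    ∃ S : Set V, G.IsIndepSet S ∧ ∀ v ∉ S, ∃ w ∈ S, G.Adj w v := by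
  obtain ⟨S, -, hS⟩ := Finite.exists_le_maximal (p := G.IsIndepSet) (a := ∅) (Set.pairwise_empty _)
  refine ⟨S, hS.prop, fun v hv => ?_⟩
  by_contra! h
  have hins : G.IsIndepSet (insert v S) :=
    Set.Pairwise.insert hS.prop fun w hw _ => ⟨fun hvw => h w hw hvw.symm, h w hw⟩
  exact hv (hS.le_of_ge hins (Set.subset_insert v S) (Set.mem_insert v S))

/-- Let `G` be a finite simple graph with at least one edge and let `l`
be the length of a longest path of `G`.  Then the vertex set can be partitioned into
`V₁` and `V₂` such that `V₂` is independent and every path of the induced subgraph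
`G[V₁]` has length strictly less than `l`. -/
theorem stmt13 {V : Type*} [Fintype V] (G : SimpleGraph V)
    (hE : G.edgeSet.Nonempty) (l : ℕ)
    (hl : IsGreatest {r | ∃ (u v : V) (p : G.Walk u v), p.IsPath ∧ p.length = r} l) :
    ∃ V₁ V₂ : Set V, Disjoint V₁ V₂ ∧ V₁ ∪ V₂ = Set.univ ∧
      (∀ u ∈ V₂, ∀ v ∈ V₂, ¬ G.Adj u v) ∧
      (∀ (u v : ↥V₁) (p : (G.induce V₁).Walk u v), p.IsPath → p.length < l) := by
  obtain ⟨S, hS, hdom⟩ := G.exists_isIndepSet_dominating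
  refine ⟨Sᶜ, S, disjoint_compl_left, Set.compl_union_self S,
    fun u hu v hv huv => hS hu hv huv.ne huv, fun u v p hp => ?_⟩
  obtain ⟨w, hwS, hwu⟩ := hdom u u.2
  let f := (SimpleGraph.Embedding.induce (G := G) Sᶜ).toHom
  have hq : (p.map f).IsPath := hp.map Subtype.val_injective
  have hw : w ∉ (p.map f).support := by
    rw [SimpleGraph.Walk.support_map, List.mem_map]
    rintro ⟨x, -, rfl⟩
    exact x.2 hwS
  have hle : (p.map f).length + 1 ≤ l :=
    hl.2 ⟨w, f v, .cons hwu (p.map f), hq.cons hw, rfl⟩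
  rwa [SimpleGraph.Walk.length_map] at hle
end
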